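/- Let f be a polynomial over a field K in variables X_1,…,X_n and let 0 ≤ k ≤ n. Then spc_k(f) = Σ_{ℓ=0}^{k} (−1)^{k−ℓ} · C(n−ℓ, k−ℓ) · Σ_{A ⊆ {X_1,…,X_n}, |A| = ℓ} f|_A, where C(·,·) denotes the binomial coefficient. -/

import Mathlib

open MvPolynomial

/-- `f|_A`: the polynomial obtained from `f` by substituting `0` for every
variable not in `A`. -/
noncomputable def restrictTo {K : Type*} [Field K] {n : ℕ} (A : Finset (Fin n))
    (f : MvPolynomial (Fin n) K) : MvPolynomial (Fin n) K :=
  aeval (fun i => if i ∈ A then X i else 0) f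

/-- `spc k f`: the sum of the monomials of `f` whose support has size exactly `k`. -/
noncomputable def spc {K : Type*} [Field K] {n : ℕ} (k : ℕ)
    (f : MvPolynomial (Fin n) K) : MvPolynomial (Fin n) K :=
  ∑ d ∈ f.support.filter (fun d => d.support.card = k), monomial d (coeff d f)

theorem coeff_restrictTo {K : Type*} [Field K] {n : ℕ} (A : Finset (Fin n))
    (f : MvPolynomial (Fin n) K) (d : Fin n →₀ ℕ) :
    coeff d (restrictTo A f) = if d.support ⊆ A then coeff d f else 0 := by
  unfold restrictTo
  induction f using MvPolynomial.induction_on' with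
  | add p q hp hq =>
    rw [map_add, coeff_add, hp, hq, coeff_add]
    split_ifs <;> simp
  | monomial e a =>
    rw [aeval_monomial]
    by_cases he : e.support ⊆ A
    · have h1 : (e.prod fun i k => (if i ∈ A then (X i : MvPolynomial (Fin n) K) else 0) ^ k)
          = e.prod fun i k => X i ^ k := by
        apply Finsupp.prod_congr
        intro i hi
        rw [if_pos (he hi)]
      rw [h1, algebraMap_eq, ← monomial_eq]
      split_ifs with hd
      · rfl
      · rw [coeff_monomial, if_neg]
        rintro rfl
        exact hd he
    · obtain ⟨i, hi, hiA⟩ := Finset.not_subset.mp he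
      have h1 : (e.prod fun i k => (if i ∈ A then (X i : MvPolynomial (Fin n) K) else 0) ^ k)
          = 0 := by
        apply Finset.prod_eq_zero hi
        simp only [if_neg hiA]
        exact zero_pow (Finsupp.mem_support_iff.mp hi)
      rw [h1, mul_zero, coeff_zero]
      split_ifs with hd
      · rw [coeff_monomial, if_neg]
        rintro rfl
        exact he hd
      · rfl

theorem card_supersets {n : ℕ} (S : Finset (Fin n)) (j : ℕ) :
    ((Finset.powersetCard (S.card + j) (Finset.univ : Finset (Fin n))).filter
      (fun A => S ⊆ A)).card = (n - S.card).choose j := by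
  have h : n - S.card = (Sᶜ).card := by rw [Finset.card_compl, Fintype.card_fin]
  rw [h, ← Finset.card_powersetCard]
  refine Finset.card_bij' (fun A _ => A \ S) (fun B _ => B ∪ S) ?_ ?_ ?_ ?_
  · intro A hA
    simp only [Finset.mem_filter, Finset.mem_powersetCard, Finset.subset_univ, true_and] at hA ⊢
    refine ⟨fun x hx => by simp at hx ⊢; exact hx.2, ?_⟩
    rw [Finset.card_sdiff_of_subset hA.2, hA.1]; omega
  · intro B hB
    simp only [Finset.mem_filter, Finset.mem_powersetCard, Finset.subset_univ, true_and] at hB ⊢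
    refine ⟨?_, Finset.subset_union_right⟩
    rw [Finset.card_union_of_disjoint, hB.2, add_comm]
    exact Finset.disjoint_left.mpr fun x hx => Finset.mem_compl.mp (hB.1 hx)
  · intro A hA
    simp only [Finset.mem_filter] at hA
    exact Finset.sdiff_union_of_subset hA.2
  · intro B hB
    simp only [Finset.mem_powersetCard] at hB
    ext x
    have := @hB.1 x
    simp only [Finset.mem_compl] at this
    simp only [Finset.mem_sdiff, Finset.mem_union]
    tauto

theorem alt_sum {K : Type*} [Field K] (N m : ℕ) (hm : m ≤ N) :
    ∑ j ∈ Finset.range (m + 1),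
      ((-1 : K) ^ (m - j) * ((N - j).choose (m - j) : K)) * (N.choose j : K)
      = if m = 0 then 1 else 0 := by
  have h : ∀ j ∈ Finset.range (m + 1),
      ((-1 : K) ^ (m - j) * ((N - j).choose (m - j) : K)) * (N.choose j : K)
      = (N.choose m : K) * (1 ^ j * (-1 : K) ^ (m - j) * (m.choose j : K)) := by
    intro j hj
    have hj' : j ≤ m := by simp at hj; omega
    have := congrArg (Nat.cast : ℕ → K) (Nat.choose_mul (n := N) hj')
    push_cast at this
    rw [one_pow]
    linear_combination (-(-1 : K) ^ (m - j)) * this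
  rw [Finset.sum_congr rfl h, ← Finset.mul_sum, ← add_pow, add_neg_cancel]
  split_ifs with h0
  · subst h0; simp
  · rw [zero_pow h0, mul_zero]

theorem coeff_sum_eq {K : Type*} [Field K] {n : ℕ} (S : Finset (Fin n)) (k : ℕ) (hk : k ≤ n) :
    ∑ l ∈ Finset.range (k + 1), ((-1 : K) ^ (k - l) * ((n - l).choose (k - l) : K)) *
      (((Finset.powersetCard l (Finset.univ : Finset (Fin n))).filter
      (fun A => S ⊆ A)).card : K) = if S.card = k then 1 else 0 := by
  have hz : ∀ l, l < S.card → ((Finset.powersetCard l (Finset.univ : Finset (Fin n))).filter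
      (fun A => S ⊆ A)).card = 0 := by
    intro l hl
    rw [Finset.card_eq_zero, Finset.filter_eq_empty_iff]
    intro A hA hS
    have := Finset.card_le_card hS
    rw [(Finset.mem_powersetCard.mp hA).2] at this
    omega
  rcases lt_or_ge k S.card with h | h
  · rw [if_neg (by omega)]
    apply Finset.sum_eq_zero
    intro l hl
    rw [hz l (by simp at hl; omega)]; simp
  · obtain ⟨m, rfl⟩ := Nat.exists_eq_add_of_le h
    rw [add_assoc, Finset.sum_range_add, Finset.sum_eq_zero, zero_add]
    · have := alt_sum (K := K) (n - S.card) m (by omega)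
      simp only [card_supersets, ← Nat.sub_sub, Nat.add_sub_cancel_left]
      rw [this]
      simp
    · intro l hl
      rw [hz l (by simpa using hl)]; simp

/-- `spc_k f = ∑_{ℓ=0}^{k} (-1)^{k-ℓ} C(n-ℓ, k-ℓ) ∑_{|A| = ℓ} f|_A`. -/
theorem stmt_6 {K : Type*} [Field K] {n : ℕ} (f : MvPolynomial (Fin n) K)
    (k : ℕ) (hk : k ≤ n) :
    spc k f =
      ∑ ℓ ∈ Finset.range (k + 1),
        C ((-1 : K) ^ (k - ℓ) * ((n - ℓ).choose (k - ℓ) : K)) *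
          ∑ A ∈ Finset.powersetCard ℓ (Finset.univ : Finset (Fin n)),
            restrictTo A f := by
  ext d
  have hL : coeff d (spc k f) = if d.support.card = k then coeff d f else 0 := by
    unfold spc
    rw [coeff_sum]
    simp only [coeff_monomial]
    rw [Finset.sum_ite_eq']
    by_cases h : coeff d f = 0 <;> simp [h]
  rw [hL, coeff_sum]
  simp only [coeff_C_mul, coeff_sum, coeff_restrictTo]
  have := congrArg (· * coeff d f) (coeff_sum_eq (K := K) d.support k hk)
  simp only [Finset.sum_mul, ite_mul, one_mul, zero_mul] at this
  rw [← this]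
  apply Finset.sum_congr rfl
  intro l _
  rw [← Finset.sum_filter, Finset.sum_const, nsmul_eq_mul]
  ring
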